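/- Let φ : R_A → R_B be a graded ring isomorphism that is k-stable, let ℓ > k+2 be the smallest integer with φ(x_{k+1}) ∈ F_ℓ(B), and set p := b_{ℓ,ℓ−1}. If p is odd, then there exist a strictly lower-triangular integer matrix B' whose i-th row coincides with that of B for all i < ℓ−2, and a k-stable graded ring isomorphism g : R_B → R_{B'} that is a finite composition of switching and twisting isomorphisms, such that (g ∘ φ)(x_{k+1}) ∈ F_{ℓ−1}(B'). -/

import Mathlib

open MvPolynomial

namespace Bott

/-- A square integer matrix indexed by `Fin n` (rows, columns).  We think of it as the
matrix `A = (a_{ij})` defining a Bott tower; strict lower triangularity is the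
predicate `SLT` below. -/
abbrev Mat (n : ℕ) := Fin n → Fin n → ℤ

/-- `a` is strictly lower triangular: `a i j = 0` unless `j < i`. -/
def SLT {n : ℕ} (a : Mat n) : Prop := ∀ i j : Fin n, a i j ≠ 0 → (j : ℕ) < (i : ℕ)

section Defs

variable (n : ℕ)

/-- The linear form `α_i = ∑_{j<i} a_{ij} x_j` (the terms with `j ≥ i` vanish for a
strictly lower triangular matrix). -/
noncomputable def alpha (a : Mat n) (i : Fin n) : MvPolynomial (Fin n) ℤ :=
  ∑ j, C (a i j) * X j

/-- The ideal `(x_i² − α_i x_i : 1 ≤ i ≤ n)`. -/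
noncomputable def bottIdeal (a : Mat n) : Ideal (MvPolynomial (Fin n) ℤ) :=
  Ideal.span (Set.range fun i : Fin n => X i ^ 2 - alpha n a i * X i)

/-- The Bott ring `R_A = ℤ[x_1,…,x_n]/(x_i² − α_i x_i)`. -/
abbrev BRing (a : Mat n) := MvPolynomial (Fin n) ℤ ⧸ bottIdeal n a

/-- Quotient projection onto the Bott ring. -/
noncomputable def bmk (a : Mat n) : MvPolynomial (Fin n) ℤ →+* BRing n a :=
  Ideal.Quotient.mk _

/-- The class `x_i` in the Bott ring (0-based: `bx a i` is the paper's `x_{i+1}`). -/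
noncomputable def bx (a : Mat n) (i : Fin n) : BRing n a := bmk n a (X i)

/-- The class of `α_i` in the Bott ring. -/
noncomputable def bal (a : Mat n) (i : Fin n) : BRing n a := bmk n a (alpha n a i)

/-- `F_k(A)`: the span of the first `k` degree-2 generators (paper's `x_1, …, x_k`,
0-based indices `< k`). -/
noncomputable def F (a : Mat n) (k : ℕ) : Submodule ℤ (BRing n a) :=
  Submodule.span ℤ (bx n a '' {i : Fin n | (i : ℕ) < k})

/-- `H²(A)`: the span of all the degree-2 generators. -/
noncomputable def H2 (a : Mat n) : Submodule ℤ (BRing n a) :=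
  Submodule.span ℤ (Set.range (bx n a))

/-- `ht(η) = min {k | η ∈ F_k(A)}`. -/
noncomputable def ht (a : Mat n) (η : BRing n a) : ℕ := sInf {k | η ∈ F n a k}

/-- A ring isomorphism between Bott rings is graded iff it preserves the degree-2
components in both directions (both rings are generated in degree 2, so this is
equivalent to preserving the whole grading). -/
def IsGraded (a b : Mat n) (φ : BRing n a ≃+* BRing n b) : Prop :=
  (∀ z ∈ H2 n a, φ z ∈ H2 n b) ∧ (∀ z ∈ H2 n b, φ.symm z ∈ H2 n a)

/-- `φ` is `k`-stable: `φ(F_k(A)) ⊆ F_k(B)`. -/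
def IsStable (a b : Mat n) (k : ℕ) (φ : BRing n a ≃+* BRing n b) : Prop :=
  ∀ z ∈ F n a k, φ z ∈ F n b k

/-! ### Rationalizations -/

/-- The linear form `α_i` with rational coefficients. -/
noncomputable def alphaQ (a : Mat n) (i : Fin n) : MvPolynomial (Fin n) ℚ :=
  ∑ j, C ((a i j : ℚ)) * X j

noncomputable def bottIdealQ (a : Mat n) : Ideal (MvPolynomial (Fin n) ℚ) :=
  Ideal.span (Set.range fun i : Fin n => X i ^ 2 - alphaQ n a i * X i)

/-- The rationalized Bott ring `R_A ⊗ ℚ`. -/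
abbrev BRingQ (a : Mat n) := MvPolynomial (Fin n) ℚ ⧸ bottIdealQ n a

noncomputable def bmkQ (a : Mat n) : MvPolynomial (Fin n) ℚ →+* BRingQ n a :=
  Ideal.Quotient.mk _

noncomputable def bxQ (a : Mat n) (i : Fin n) : BRingQ n a := bmkQ n a (X i)

noncomputable def balQ (a : Mat n) (i : Fin n) : BRingQ n a := bmkQ n a (alphaQ n a i)

/-- `F_k(A) ⊗ ℚ` inside `R_A ⊗ ℚ`. -/
noncomputable def FQ (a : Mat n) (k : ℕ) : Submodule ℚ (BRingQ n a) :=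
  Submodule.span ℚ (bxQ n a '' {i : Fin n | (i : ℕ) < k})

/-- The canonical map `R_A → R_A ⊗ ℚ`. -/
noncomputable def toQ (a : Mat n) : BRing n a →+* BRingQ n a :=
  Ideal.Quotient.lift (bottIdeal n a)
    ((bmkQ n a).comp (MvPolynomial.map (Int.castRingHom ℚ)))
    (by
      intro p hp
      have hmap : ∀ i : Fin n,
          MvPolynomial.map (Int.castRingHom ℚ) (alpha n a i) = alphaQ n a i := by
        intro i
        simp [alpha, alphaQ, map_sum]
      have h : bottIdeal n a ≤
          Ideal.comap (MvPolynomial.map (Int.castRingHom ℚ)) (bottIdealQ n a) := by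
        rw [bottIdeal, Ideal.span_le]
        rintro _ ⟨i, rfl⟩
        simp only [SetLike.mem_coe, Ideal.mem_comap, map_sub, map_mul, map_pow,
          MvPolynomial.map_X, hmap]
        exact Ideal.subset_span ⟨i, rfl⟩
      rw [RingHom.comp_apply]
      exact Ideal.Quotient.eq_zero_iff_mem.mpr (h hp))

/-- The truncated linear form `β̄_ℓ` (rational version): for a 0-based row index `li`,
this is `∑_{k ≤ j < li} b_{li,j} y_j`, i.e. the paper's `β_ℓ` with its terms in
`F_k(B)` removed. -/
noncomputable def bbarQ (b : Mat n) (k : ℕ) (li : Fin n) : BRingQ n b :=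
  ∑ j ∈ Finset.univ.filter (fun j : Fin n => k ≤ (j : ℕ) ∧ j < li),
    (b li j : ℚ) • bxQ n b j

/-- Half of the truncated linear form `β̄_ℓ / 2` (meaningful when all relevant entries
are even), as an element of the integral Bott ring. -/
noncomputable def bbarHalf (b : Mat n) (k : ℕ) (li : Fin n) : BRing n b :=
  ∑ j ∈ Finset.univ.filter (fun j : Fin n => k ≤ (j : ℕ) ∧ j < li),
    (b li j / 2) • bx n b j

/-! ### Switching and twisting -/

/-- The matrix obtained from `b` by exchanging the rows and columns `p` and `q`. -/
def swapMat (b : Mat n) (p q : Fin n) : Mat n :=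
  fun i j => b (Equiv.swap p q i) (Equiv.swap p q j)

/-- `g : R_C → R_{C'}` is a switching isomorphism: for some `j` (0-based `J`) with
`c_{j+1,j} = 0`, `C'` is obtained from `C` by exchanging the `j`-th and `(j+1)`-st rows
and columns, and `g` swaps the `j`-th and `(j+1)`-st generators and fixes the others. -/
def IsSwitch (c c' : Mat n) (g : BRing n c ≃+* BRing n c') : Prop :=
  IsGraded n c c' g ∧
  ∃ (J : ℕ) (hJ : J + 1 < n),
    c ⟨J + 1, hJ⟩ ⟨J, by omega⟩ = 0 ∧
    c' = swapMat n c ⟨J, by omega⟩ ⟨J + 1, hJ⟩ ∧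
    ∀ i, g (bx n c i) = bx n c' (Equiv.swap (⟨J, by omega⟩ : Fin n) ⟨J + 1, hJ⟩ i)

/-- `g : R_C → R_{C'}` is a twisting isomorphism: for some `j` (0-based `J`) and
`v ∈ F_{j−1}(C)` with `v(γ_j − v) = 0`, the rows of `C'` before `j` agree with those of
`C`, `γ'_j = γ_j − 2v`, and `g` is a graded isomorphism fixing the first `j−1`
generators. -/
def IsTwist (c c' : Mat n) (g : BRing n c ≃+* BRing n c') : Prop :=
  IsGraded n c c' g ∧
  ∃ (J : ℕ) (hJ : J < n) (v : BRing n c),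
    v ∈ F n c J ∧ v * (bal n c ⟨J, hJ⟩ - v) = 0 ∧
    (∀ i : Fin n, (i : ℕ) < J → ∀ m, c' i m = c i m) ∧
    ((∑ m, c' ⟨J, hJ⟩ m • bx n c m) = bal n c ⟨J, hJ⟩ - 2 • v) ∧
    (∀ i : Fin n, (i : ℕ) < J → g (bx n c i) = bx n c' i)

/-- `IsMoveComp n c c' g` : `g : R_C → R_{C'}` is a finite (possibly empty) composition
of switching and twisting isomorphisms. -/
inductive IsMoveComp : ∀ c c' : Mat n, (BRing n c ≃+* BRing n c') → Prop
  | refl (c : Mat n) : IsMoveComp c c (RingEquiv.refl _)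
  | switch {c c' c'' : Mat n} {g : BRing n c ≃+* BRing n c'}
      {g' : BRing n c' ≃+* BRing n c''} :
      IsMoveComp c c' g → IsSwitch n c' c'' g' → IsMoveComp c c'' (g.trans g')
  | twist {c c' c'' : Mat n} {g : BRing n c ≃+* BRing n c'}
      {g' : BRing n c' ≃+* BRing n c''} :
      IsMoveComp c c' g → IsTwist n c' c'' g' → IsMoveComp c c'' (g.trans g')

end Defs

/-! ### Block matrices for ℚ-trivial Bott manifolds -/

/-- Starting (0-based) index of the `s`-th block for the partition `lam`. -/
def blockStart (t : ℕ) (lam : Fin t → ℕ) (s : Fin t) : ℕ :=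
  ∑ s' ∈ Finset.univ.filter (fun s' : Fin t => s' < s), lam s'

/-- The block-diagonal matrix with diagonal blocks `H_{λ_1}, …, H_{λ_t}`, where `H_j`
is the `j × j` strictly lower triangular matrix whose first column below the diagonal
consists of `1`s and whose other entries vanish. -/
def blockMat (n t : ℕ) (lam : Fin t → ℕ) : Mat n := fun i j =>
  if ∃ s : Fin t, (j : ℕ) = blockStart t lam s ∧ blockStart t lam s < (i : ℕ) ∧
      (i : ℕ) < blockStart t lam s + lam s then 1 else 0

/-- `H²(ℋ_{λ_s})`: the subgroup of the degree-2 component spanned by the generators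
belonging to the `s`-th block. -/
noncomputable def blockH2 (n t : ℕ) (lam : Fin t → ℕ) (s : Fin t) :
    Submodule ℤ (BRing n (blockMat n t lam)) :=
  Submodule.span ℤ (bx n (blockMat n t lam) ''
    {i : Fin n | blockStart t lam s ≤ (i : ℕ) ∧ (i : ℕ) < blockStart t lam s + lam s})

end Bott

namespace Bott

section Aux

variable {n : ℕ}

lemma bx_sq (a : Mat n) (i : Fin n) : bx n a i * bx n a i = bal n a i * bx n a i := by
  have h : X i ^ 2 - alpha n a i * X i ∈ bottIdeal n a := Ideal.subset_span ⟨i, rfl⟩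
  have h2 : bmk n a (X i ^ 2 - alpha n a i * X i) = 0 := Ideal.Quotient.eq_zero_iff_mem.mpr h
  rw [map_sub, map_pow, map_mul, sub_eq_zero, pow_two] at h2
  exact h2

lemma bal_eq (a : Mat n) (i : Fin n) : bal n a i = ∑ j, a i j • bx n a j := by
  simp only [bal, alpha, map_sum, map_mul]
  refine Finset.sum_congr rfl fun j _ => ?_
  rw [zsmul_eq_mul, bx]
  congr 1

/-- Ring hom out of a Bott ring. -/
noncomputable def bhom (a : Mat n) {S : Type*} [CommRing S] (f : Fin n → S)
    (hf : ∀ i, f i * f i = (∑ j, a i j • f j) * f i) : BRing n a →+* S :=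
  Ideal.Quotient.lift (bottIdeal n a) (MvPolynomial.eval₂Hom (Int.castRingHom S) f) (by
    intro p hp
    have h : bottIdeal n a ≤ RingHom.ker (MvPolynomial.eval₂Hom (Int.castRingHom S) f) := by
      rw [bottIdeal, Ideal.span_le]
      rintro _ ⟨i, rfl⟩
      have := hf i
      simp only [SetLike.mem_coe, RingHom.mem_ker, alpha, map_sub, map_mul, map_sum,
        eval₂Hom_X', eval₂Hom_C, pow_two, this, zsmul_eq_mul]
      simp
    exact h hp)

lemma bhom_bx (a : Mat n) {S : Type*} [CommRing S] (f : Fin n → S)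
    (hf : ∀ i, f i * f i = (∑ j, a i j • f j) * f i) (i : Fin n) :
    bhom a f hf (bx n a i) = f i := by
  simp only [bhom, bx, bmk]
  erw [Ideal.Quotient.lift_mk]
  simp

lemma bring_hom_ext (a : Mat n) {S : Type*} [CommRing S] (f g : BRing n a →+* S)
    (h : ∀ i, f (bx n a i) = g (bx n a i)) : f = g := by
  apply Ideal.Quotient.ringHom_ext
  apply MvPolynomial.ringHom_ext
  · intro r
    have : (C r : MvPolynomial (Fin n) ℤ) = ((r : ℤ) : MvPolynomial (Fin n) ℤ) := by simp
    simp [this]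
  · intro i
    exact h i

lemma exists_equiv (a b : Mat n) (f : Fin n → BRing n b) (f' : Fin n → BRing n a)
    (hf : ∀ i, f i * f i = (∑ j, a i j • f j) * f i)
    (hf' : ∀ i, f' i * f' i = (∑ j, b i j • f' j) * f' i)
    (h1 : ∀ i (h : BRing n b →+* BRing n a), (∀ j, h (bx n b j) = f' j) → h (f i) = bx n a i)
    (h2 : ∀ i (h : BRing n a →+* BRing n b), (∀ j, h (bx n a j) = f j) → h (f' i) = bx n b i) :
    ∃ g : BRing n a ≃+* BRing n b, (∀ i, g (bx n a i) = f i) ∧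
      ∀ i, g.symm (bx n b i) = f' i := by
  refine ⟨RingEquiv.ofRingHom (bhom a f hf) (bhom b f' hf') ?_ ?_, ?_, ?_⟩
  · apply bring_hom_ext
    intro i
    simp only [RingHom.comp_apply, bhom_bx, RingHom.id_apply]
    exact h2 i _ (bhom_bx a f hf)
  · apply bring_hom_ext
    intro i
    simp only [RingHom.comp_apply, bhom_bx, RingHom.id_apply]
    exact h1 i _ (bhom_bx b f' hf')
  · intro i; exact bhom_bx a f hf i
  · intro i; exact bhom_bx b f' hf' i

lemma bx_mem_H2 (a : Mat n) (i : Fin n) : bx n a i ∈ H2 n a := Submodule.subset_span ⟨i, rfl⟩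

lemma bx_mem_F (a : Mat n) (k : ℕ) (i : Fin n) (h : (i : ℕ) < k) : bx n a i ∈ F n a k :=
  Submodule.subset_span ⟨i, h, rfl⟩

lemma isGraded_of (a b : Mat n) (g : BRing n a ≃+* BRing n b)
    (h1 : ∀ i, g (bx n a i) ∈ H2 n b) (h2 : ∀ i, g.symm (bx n b i) ∈ H2 n a) :
    IsGraded n a b g := by
  constructor
  · intro z hz
    induction hz using Submodule.span_induction with
    | mem x hx => obtain ⟨i, rfl⟩ := hx; exact h1 i
    | zero => simp
    | add x y _ _ hx hy => rw [map_add]; exact add_mem hx hy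
    | smul r x _ hx => rw [map_zsmul]; exact Submodule.smul_mem _ _ hx
  · intro z hz
    induction hz using Submodule.span_induction with
    | mem x hx => obtain ⟨i, rfl⟩ := hx; exact h2 i
    | zero => simp
    | add x y _ _ hx hy => rw [map_add]; exact add_mem hx hy
    | smul r x _ hx => rw [map_zsmul]; exact Submodule.smul_mem _ _ hx

lemma isStable_of (a b : Mat n) (k : ℕ) (g : BRing n a ≃+* BRing n b)
    (h1 : ∀ i : Fin n, (i : ℕ) < k → g (bx n a i) = bx n b i) :
    IsStable n a b k g := by
  intro z hz
  induction hz using Submodule.span_induction with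
  | mem x hx => obtain ⟨i, hi, rfl⟩ := hx; rw [h1 i hi]; exact bx_mem_F _ _ _ hi
  | zero => simp
  | add x y _ _ hx hy => rw [map_add]; exact add_mem hx hy
  | smul r x _ hx => rw [map_zsmul]; exact Submodule.smul_mem _ _ hx

lemma mem_F_coef (a : Mat n) (k : ℕ) (z : BRing n a) (hz : z ∈ F n a k) :
    ∃ c : Fin n → ℤ, (∀ i : Fin n, k ≤ (i : ℕ) → c i = 0) ∧ z = ∑ i, c i • bx n a i := by
  induction hz using Submodule.span_induction with
  | mem x hx =>
    obtain ⟨i, hi, rfl⟩ := hx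
    refine ⟨Pi.single i 1, ?_, ?_⟩
    · intro j hj
      have : j ≠ i := by rintro rfl; simp at hi; omega
      simp [this]
    · simp [Pi.single_apply, ite_smul]
  | zero => exact ⟨0, by simp, by simp⟩
  | add x y _ _ hx hy =>
    obtain ⟨c, hc, rfl⟩ := hx
    obtain ⟨d, hd, rfl⟩ := hy
    refine ⟨c + d, fun i hi => by simp [hc i hi, hd i hi], ?_⟩
    simp [add_smul, Finset.sum_add_distrib]
  | smul r x _ hx =>
    obtain ⟨c, hc, rfl⟩ := hx
    refine ⟨r • c, fun i hi => by simp [hc i hi], ?_⟩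
    simp [mul_smul, Finset.smul_sum]

lemma sum_mem_F (a : Mat n) (k : ℕ) (c : Fin n → ℤ) (hc : ∀ i : Fin n, k ≤ (i : ℕ) → c i = 0) :
    ∑ i, c i • bx n a i ∈ F n a k := by
  refine Submodule.sum_mem _ fun i _ => ?_
  by_cases h : (i : ℕ) < k
  · exact Submodule.smul_mem _ _ (bx_mem_F _ _ _ h)
  · rw [hc i (by omega)]; simp

/-- Quadratic relations are detected on coefficients. -/
lemma coef_rel (b : Mat n) (hb : SLT b) (z e : Fin n → ℤ)
    (h : (∑ i, z i • bx n b i) * (∑ i, e i • bx n b i) = 0) (i j : Fin n) (hij : i < j) :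
    z i * e j + z j * e i + b j i * (z j * e j) = 0 := by
  let D := QuadraticAlgebra (DualNumber ℤ) 0 (b j i • DualNumber.eps)
  let s : D := ⟨DualNumber.eps, 0⟩
  let t : D := ⟨0, 1⟩
  have hss : s * s = 0 := by
    ext <;> simp [s, D]
  have htt : t * t = b j i • (s * t) := by
    ext <;> simp [s, t, D]
  let f : Fin n → D := fun m => if m = i then s else if m = j then t else 0
  have hsum : ∀ c : Fin n → ℤ, ∑ m, c m • f m = c i • s + c j • t := by
    intro c
    have : ∀ m, c m • f m = (if m = i then c i • s else 0) + (if m = j then c j • t else 0) := by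
      intro m
      by_cases h1 : m = i
      · subst h1; simp [f, hij.ne]
      · by_cases h2 : m = j
        · subst h2; simp [f, h1]
        · simp [f, h1, h2]
    simp [this, Finset.sum_add_distrib]
  have hz : ∀ i j : Fin n, i ≤ j → b i j = 0 := by
    intro i j hij
    by_contra h
    have := hb i j h
    have : (i : ℕ) ≤ j := hij
    omega
  have hf : ∀ m, f m * f m = (∑ j, b m j • f j) * f m := by
    intro m
    rw [hsum]
    by_cases h1 : m = i
    · subst h1; simp [f, hss, hz m m le_rfl, hz m j hij.le]
    · by_cases h2 : m = j
      · subst h2; simp [f, h1, htt, hz m m le_rfl, mul_assoc]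
      · simp [f, h1, h2]
  have key := congrArg (bhom b f hf) h
  simp only [map_mul, map_sum, map_zsmul, bhom_bx, hsum, map_zero] at key
  have h3 : (z i • s + z j • t) * (e i • s + e j • t)
      = (z i * e j + z j * e i + b j i * (z j * e j)) • (s * t) := by
    have : (z i • s + z j • t) * (e i • s + e j • t) =
      (z i * e i) • (s * s) + (z i * e j + z j * e i) • (s * t) + (z j * e j) • (t * t) := by
      simp only [zsmul_eq_mul]; push_cast; ring
    rw [this, hss, htt]
    simp only [zsmul_eq_mul]; push_cast; ring
  rw [h3] at key
  have h4 := congrArg (fun d : D => TrivSqZeroExt.snd (QuadraticAlgebra.im d)) key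
  simpa [s, t, D] using h4

lemma exists_switch (c : Mat n) (hc : SLT c) (P Q : Fin n) (hPQ : (Q : ℕ) = P + 1)
    (h0 : c Q P = 0) :
    ∃ g : BRing n c ≃+* BRing n (swapMat n c P Q),
      IsSwitch n c (swapMat n c P Q) g ∧ SLT (swapMat n c P Q) ∧
      ∀ i, g (bx n c i) = bx n (swapMat n c P Q) (Equiv.swap P Q i) := by
  have hrel1 : ∀ i, ∑ j, c i j • bx n (swapMat n c P Q) (Equiv.swap P Q j)
      = bal n (swapMat n c P Q) (Equiv.swap P Q i) := by
    intro i
    rw [bal_eq, ← Equiv.sum_comp (Equiv.swap P Q)]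
    simp [swapMat]
  have hrel2 : ∀ i, ∑ j, swapMat n c P Q i j • bx n c (Equiv.swap P Q j)
      = bal n c (Equiv.swap P Q i) := by
    intro i
    rw [bal_eq, ← Equiv.sum_comp (Equiv.swap P Q)]
    simp [swapMat]
  obtain ⟨g, hg, hg'⟩ := exists_equiv c (swapMat n c P Q)
    (fun i => bx n (swapMat n c P Q) (Equiv.swap P Q i))
    (fun i => bx n c (Equiv.swap P Q i))
    (fun i => by rw [hrel1, bx_sq]) (fun i => by rw [hrel2, bx_sq])
    (fun i h hh => by rw [hh]; simp) (fun i h hh => by rw [hh]; simp)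
  have hQn := Q.2
  have eP : (⟨(P : ℕ), by omega⟩ : Fin n) = P := rfl
  have eQ : (⟨(P : ℕ) + 1, by omega⟩ : Fin n) = Q := Fin.ext hPQ.symm
  refine ⟨g, ⟨isGraded_of _ _ _ (fun i => ?_) (fun i => ?_), P, by omega, ?_, ?_, ?_⟩, ?_, hg⟩
  · rw [hg]; exact bx_mem_H2 _ _
  · rw [hg']; exact bx_mem_H2 _ _
  · rw [eQ]; exact h0
  · rw [eQ]
  · rw [eQ]; exact hg
  · intro i j hij
    simp only [swapMat] at hij
    have h1 := hc _ _ hij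
    have h2 : ∀ m : Fin n, ((Equiv.swap P Q m : Fin n) : ℕ) =
        if (m : ℕ) = P then (Q : ℕ) else if (m : ℕ) = Q then (P : ℕ) else m := by
      intro m
      rw [Equiv.swap_apply_def]
      simp only [Fin.ext_iff]
      split_ifs <;> rfl
    have h3 : ¬ (i = P ∧ j = Q) := by
      rintro ⟨rfl, rfl⟩
      simp at hij
      exact hij h0
    rw [h2, h2] at h1
    rw [Fin.ext_iff, Fin.ext_iff] at h3
    split_ifs at h1 <;> omega

/-- The twisted matrix. -/
def tw (c : Mat n) (N M : Fin n) (q : ℤ) : Mat n := fun i m =>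
  c i m + if m = N then c i M * q - (if i = M then 2 * q else 0) else 0

lemma tw_tw (c : Mat n) (N M : Fin n) (hNM : M ≠ N) (q : ℤ) : tw (tw c N M q) N M (-q) = c := by
  funext i m
  simp only [tw, hNM, if_false]
  split_ifs <;> ring

lemma tw_rel (c c' : Mat n) (N M : Fin n) (q : ℤ) (hc' : c' = tw c N M q)
    (h : (q • bx n c' N) * (bal n c' M + q • bx n c' N) = 0) (i : Fin n) :
    (bx n c' i + if i = M then q • bx n c' N else 0) *
      (bx n c' i + if i = M then q • bx n c' N else 0) =
    (∑ j, c i j • (bx n c' j + if j = M then q • bx n c' N else 0)) *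
      (bx n c' i + if i = M then q • bx n c' N else 0) := by
  have h1 : ∑ j, c i j • (bx n c' j + if j = M then q • bx n c' N else 0)
      = bal n c' i + if i = M then (2 * q) • bx n c' N else 0 := by
    have e1 : bal n c' i = ∑ j, c i j • bx n c' j
        + (c i M * q - (if i = M then 2 * q else 0)) • bx n c' N := by
      rw [bal_eq]
      have : ∀ j, c' i j • bx n c' j = c i j • bx n c' j +
          (if j = N then (c i M * q - (if i = M then 2 * q else 0)) • bx n c' N else 0) := by
        intro j
        have : c' i j = tw c N M q i j := by rw [hc']
        rw [this, tw, add_smul]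
        by_cases hj : j = N
        · subst hj; simp
        · simp [hj]
      simp only [this, Finset.sum_add_distrib, Finset.sum_ite_eq', Finset.mem_univ, if_true]
    rw [e1]
    simp only [smul_add, Finset.sum_add_distrib, smul_ite, smul_zero, Finset.sum_ite_eq',
      Finset.mem_univ, if_true]
    by_cases hi : i = M
    · simp only [hi, if_true, zsmul_eq_mul]; push_cast; ring
    · simp only [hi, if_false, zsmul_eq_mul]; push_cast; ring
  rw [h1]
  have h2 := bx_sq c' i
  by_cases hi : i = M
  · subst hi
    simp only [if_true, zsmul_eq_mul] at *
    push_cast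
    linear_combination h2 - h
  · simp [hi, h2]

lemma tw_vanish (c : Mat n) (N M : Fin n) (q t : ℤ)
    (h : q ≠ 0 → ∀ m, c M m + q * c N m = if m = N then t else 0) :
    (q • bx n c N) * (bal n c M + (q - t) • bx n c N) = 0 := by
  by_cases hq : q = 0
  · simp [hq]
  have h' := h hq
  have e : bal n c M + q • bal n c N = t • bx n c N := by
    rw [bal_eq, bal_eq, Finset.smul_sum, ← Finset.sum_add_distrib]
    have : ∀ m, c M m • bx n c m + q • c N m • bx n c m =
        if m = N then t • bx n c N else 0 := by
      intro m
      rw [← mul_smul, ← add_smul, h']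
      by_cases hm : m = N
      · subst hm; simp
      · simp [hm]
    simp only [this, Finset.sum_ite_eq', Finset.mem_univ, if_true]
  have h2 := bx_sq c N
  simp only [zsmul_eq_mul] at *
  push_cast
  linear_combination (q : BRing n c) * bx n c N * e + (q : BRing n c) ^ 2 * h2

lemma exists_twist (c : Mat n) (hc : SLT c) (N M : Fin n) (hNM : (M : ℕ) = N + 1) (q : ℤ)
    (h : q ≠ 0 → ∀ m, c M m + q * c N m = if m = N then 2 * q else 0) :
    ∃ g : BRing n c ≃+* BRing n (tw c N M q),
      IsTwist n c (tw c N M q) g ∧ SLT (tw c N M q) ∧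
      ∀ i, g (bx n c i) = bx n (tw c N M q) i +
        if i = M then q • bx n (tw c N M q) N else 0 := by
  have hne : M ≠ N := by intro h; rw [h] at hNM; omega
  have hz : ∀ i j : Fin n, (i : ℕ) ≤ j → c i j = 0 := by
    intro i j hij
    by_contra h
    have := hc i j h
    omega
  have v1 := tw_vanish c N M q (2 * q) h
  have v2 := tw_vanish (tw c N M q) N M q 0 (by
    intro hq m
    have := h hq m
    simp only [tw, hz M M le_rfl, hz N M (by omega), hne.symm, if_true, if_false]
    by_cases hm : m = N
    · simp only [hm, if_true] at *; linarith
    · simp only [hm, if_false] at *; linarith)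
  obtain ⟨g, hg, hg'⟩ := exists_equiv c (tw c N M q)
    (fun i => bx n (tw c N M q) i + if i = M then q • bx n (tw c N M q) N else 0)
    (fun i => bx n c i + if i = M then (-q) • bx n c N else 0)
    (tw_rel c _ N M q rfl (by simpa using v2))
    (tw_rel _ c N M (-q) (tw_tw c N M hne q).symm (by
      simp only [zsmul_eq_mul] at *
      push_cast at *
      linear_combination -v1))
    (fun i h hh => by
      by_cases hi : i = M
      · simp only [hi, if_true, map_add, hh, map_zsmul, hne.symm, if_false]; simp
      · simp only [hi, if_false, map_add, hh, map_zero]; simp)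
    (fun i h hh => by
      by_cases hi : i = M
      · simp only [hi, if_true, map_add, hh, map_zsmul, hne.symm, if_false]; simp
      · simp only [hi, if_false, map_add, hh, map_zero]; simp)
  refine ⟨g, ⟨isGraded_of _ _ _ (fun i => ?_) (fun i => ?_), M, M.2, q • bx n c N,
    ?_, ?_, ?_, ?_, ?_⟩, ?_, hg⟩
  · rw [hg]
    refine add_mem (bx_mem_H2 _ _) ?_
    split_ifs
    · exact Submodule.smul_mem _ _ (bx_mem_H2 _ _)
    · exact zero_mem _
  · rw [hg']
    refine add_mem (bx_mem_H2 _ _) ?_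
    split_ifs
    · exact Submodule.smul_mem _ _ (bx_mem_H2 _ _)
    · exact zero_mem _
  · exact Submodule.smul_mem _ _ (bx_mem_F _ _ _ (by omega))
  · simp only [zsmul_eq_mul, Fin.eta] at *
    push_cast at *
    linear_combination v1
  · intro i hi m
    have : i ≠ M := by rintro rfl; omega
    simp [tw, this, hz i M (by omega)]
  · simp only [Fin.eta, tw, hz M M le_rfl, if_true, add_smul, Finset.sum_add_distrib, ite_smul,
      zero_smul, Finset.sum_ite_eq', Finset.mem_univ, bal_eq, zsmul_eq_mul]
    push_cast
    ring
  · intro i hi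
    have : i ≠ M := by rintro rfl; omega
    rw [hg]; simp [this]
  · intro i m him
    by_contra hcon
    apply him
    have : m = N → i ≠ M := by rintro rfl rfl; omega
    by_cases hm : m = N
    · have hi := this hm
      subst hm
      simp [tw, hi, hz i m (by omega), hz i M (by omega)]
    · simp [tw, hm, hz i m (by omega)]

lemma isGraded_trans {a b c : Mat n} {g : BRing n a ≃+* BRing n b} {g' : BRing n b ≃+* BRing n c}
    (h : IsGraded n a b g) (h' : IsGraded n b c g') : IsGraded n a c (g.trans g') := by
  refine isGraded_of a c _ (fun i => ?_) (fun i => ?_)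
  · rw [RingEquiv.trans_apply]
    exact h'.1 _ (h.1 _ (bx_mem_H2 a i))
  · rw [RingEquiv.symm_trans_apply]
    exact h.2 _ (h'.2 _ (bx_mem_H2 c i))

/-- The integer relations forced by `η (η - w) = 0`. -/
lemma arith_rel (b : Mat n) (hb : SLT b) (z w : Fin n → ℤ) (k : ℕ) (N M L : Fin n)
    (hkN : k ≤ (N : ℕ)) (hM : (M : ℕ) = N + 1) (hL : (L : ℕ) = N + 2)
    (hw : ∀ i : Fin n, k ≤ (i : ℕ) → w i = 0) (hc : z L ≠ 0) (hp : Odd (b L M))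
    (h : ∀ i j : Fin n, i < j → z i * (z j - w j) + z j * (z i - w i)
      + b j i * (z j * (z j - w j)) = 0) :
    ∃ q : ℤ, (q ≠ 0 → ∀ m, b M m + q * b N m = if m = N then 2 * q else 0) ∧
      b M N = 2 * q ∧ b L N + q * b L M = 0 ∧ z N + q * z M = 0 := by
  have hz : ∀ i j : Fin n, (i : ℕ) ≤ j → b i j = 0 := by
    intro i j hij
    by_contra h
    have := hb i j h
    omega
  have hp0 : b L M ≠ 0 := by
    intro h0; rw [h0] at hp; simp at hp
  have eL : ∀ i : Fin n, (i : ℕ) < L → w i = 2 * z i + z L * b L i := by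
    intro i hi
    have h1 := h i L hi
    rw [hw L (by omega)] at h1
    apply mul_left_cancel₀ hc
    linarith
  have zM : 2 * z M = - (z L * b L M) := by
    have := eL M (by omega)
    rw [hw M (by omega)] at this; linarith
  have zM0 : z M ≠ 0 := by
    intro h0
    rw [h0] at zM
    have : z L * b L M = 0 := by linarith
    exact (mul_ne_zero hc hp0) this
  have eM : ∀ i : Fin n, (i : ℕ) < M → 2 * b L i = - (b L M * b M i) := by
    intro i hi
    have h1 := h i M hi
    rw [hw M (by omega), eL i (by omega)] at h1
    have h2 : b M i * z M = z L * b L i := by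
      apply mul_left_cancel₀ zM0
      linarith
    apply mul_left_cancel₀ hc
    linear_combination (-2) * h2 + b M i * zM
  have hev : Even (b M N) := by
    have h1 := eM N (by omega)
    have h2 : Even (b L M * b M N) := ⟨- b L N, by linarith⟩
    rcases Int.even_mul.mp h2 with h3 | h3
    · exact absurd h3 (Int.not_even_iff_odd.mpr hp)
    · exact h3
  obtain ⟨q, hq⟩ := hev
  have hLN : b L N + q * b L M = 0 := by
    have := eM N (by omega)
    rw [hq] at this
    linarith
  have zN : 2 * z N = - (z L * b L N) := by
    have := eL N (by omega)
    rw [hw N (by omega)] at this; linarith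
  have hzNM : z N + q * z M = 0 := by
    have : 2 * (z N + q * z M) = 0 := by
      linear_combination zN + q * zM - z L * hLN
    linarith
  refine ⟨q, ?_, by linarith, hLN, hzNM⟩
  intro hq0 m
  have zN0 : z N ≠ 0 := by
    intro h0
    have : q * z M = 0 := by linarith
    exact (mul_ne_zero hq0 zM0) this
  by_cases hm : m = N
  · subst hm
    simp only [if_true, hz m m le_rfl]; linarith
  · rw [if_neg hm]
    by_cases hm2 : (m : ℕ) < N
    · have h1 := h m N hm2
      rw [hw N (by omega), eL m (by omega)] at h1
      have h2 : b N m * z N = z L * b L m := by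
        apply mul_left_cancel₀ zN0
        linarith
      have h3 := eM m (by omega)
      have h4 : (z L * b L M) * (b M m + q * b N m) = 0 := by
        linear_combination 2 * h2 + z L * h3 - b N m * zN + z L * b N m * hLN
      rcases mul_eq_zero.mp h4 with h5 | h5
      · exact absurd h5 (mul_ne_zero hc hp0)
      · exact h5
    · have : (m : ℕ) ≠ N := fun h => hm (Fin.ext h)
      rw [hz M m (by omega), hz N m (by omega)]; simp

end Aux

end Bott

namespace Bott

/-- **Key lemma, odd case.** Let `φ : R_A → R_B` be a `k`-stable
graded ring isomorphism, `ℓ > k + 2` the smallest integer with `φ(x_{k+1}) ∈ F_ℓ(B)`,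
and `p := b_{ℓ,ℓ−1}` odd.  Then there are a strictly lower triangular matrix `B'`
whose `i`-th row agrees with that of `B` for `i < ℓ − 2` (0-based `i < ℓ − 3`), and a
`k`-stable graded ring isomorphism `g : R_B → R_{B'}`, a finite composition of
switching and twisting isomorphisms, with `(g ∘ φ)(x_{k+1}) ∈ F_{ℓ−1}(B')`. -/
theorem stmt_15 (n k : ℕ) (hk : k < n) (a b : Mat n) (ha : SLT a) (hb : SLT b)
    (φ : BRing n a ≃+* BRing n b) (hφ : IsGraded n a b φ) (hst : IsStable n a b k φ)
    (l : ℕ) (hlk : k + 2 < l) (hln : l ≤ n)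
    (hmem : φ (bx n a ⟨k, hk⟩) ∈ F n b l)
    (hmin : ∀ m < l, φ (bx n a ⟨k, hk⟩) ∉ F n b m)
    (hp : Odd (b ⟨l - 1, by omega⟩ ⟨l - 2, by omega⟩)) :
    ∃ (b' : Mat n) (g : BRing n b ≃+* BRing n b'),
      SLT b' ∧ IsMoveComp n b b' g ∧ IsGraded n b b' g ∧ IsStable n b b' k g ∧
      (∀ i : Fin n, (i : ℕ) < l - 3 → ∀ m, b' i m = b i m) ∧
      g (φ (bx n a ⟨k, hk⟩)) ∈ F n b' (l - 1) := by
  have hNn : l - 3 < n := by omega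
  have hMn : l - 2 < n := by omega
  have hLn : l - 1 < n := by omega
  obtain ⟨N, hN⟩ : ∃ N : Fin n, N = ⟨l - 3, hNn⟩ := ⟨_, rfl⟩
  obtain ⟨M, hM⟩ : ∃ M : Fin n, M = ⟨l - 2, hMn⟩ := ⟨_, rfl⟩
  obtain ⟨L, hL⟩ : ∃ L : Fin n, L = ⟨l - 1, hLn⟩ := ⟨_, rfl⟩
  rw [← hM, ← hL] at hp
  have vN : (N : ℕ) = l - 3 := by rw [hN]
  have vM : (M : ℕ) = N + 1 := by rw [hN, hM]; simp only; omega
  have vL : (L : ℕ) = N + 2 := by rw [hN, hL]; simp only; omega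
  have vL' : (L : ℕ) = M + 1 := by omega
  clear hN hM hL
  obtain ⟨z, hz0, hz⟩ := mem_F_coef b l _ hmem
  have hbal : bal n a ⟨k, hk⟩ ∈ F n a k := by
    rw [bal_eq]
    apply sum_mem_F
    intro i hi
    by_contra hcon
    have := ha _ _ hcon
    simp only at this
    omega
  obtain ⟨w, hw0, hw⟩ := mem_F_coef b k _ (hst _ hbal)
  have hzL : z L ≠ 0 := by
    intro h0
    apply hmin (l - 1) (by omega)
    rw [hz]
    apply sum_mem_F
    intro i hi
    by_cases h : i = L
    · rw [h]; exact h0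
    · have : (i : ℕ) ≠ L := fun h' => h (Fin.ext h')
      exact hz0 i (by omega)
  have hrel : (∑ i, z i • bx n b i) * (∑ i, (z i - w i) • bx n b i) = 0 := by
    simp only [sub_smul, Finset.sum_sub_distrib]
    rw [← hz, ← hw, mul_sub, ← map_mul, ← map_mul, bx_sq, mul_comm, sub_self]
  obtain ⟨q, hq1, hq0, hq2, hq3⟩ := arith_rel b hb z w k N M L (by omega) vM vL hw0 hzL hp
    (fun i j hij => coef_rel b hb z (fun i => z i - w i) hrel i j hij)
  obtain ⟨g1, t1, s1, e1⟩ := exists_twist b hb N M vM q hq1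
  have nNM : N ≠ M := by intro h; rw [h] at vM; omega
  have nNL : N ≠ L := by intro h; rw [h] at vL; omega
  have nML : M ≠ L := by intro h; rw [h] at vL'; omega
  have hbz : ∀ i j : Fin n, (i : ℕ) ≤ j → b i j = 0 := by
    intro i j hij
    by_contra h
    have := hb i j h
    omega
  have hMN : tw b N M q M N = 0 := by
    simp only [tw, if_true, hbz M M le_rfl]
    linarith
  obtain ⟨g2, t2, s2, e2⟩ := exists_switch (tw b N M q) s1 N M vM hMN
  have hLM : swapMat n (tw b N M q) N M L M = 0 := by
    simp only [swapMat, Equiv.swap_apply_right, Equiv.swap_apply_of_ne_of_ne nNL.symm nML.symm]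
    simp only [tw, if_true, nML.symm, if_false]
    linarith
  obtain ⟨g3, t3, s3, e3⟩ := exists_switch _ s2 M L vL' hLM
  refine ⟨_, ((((RingEquiv.refl _).trans g1).trans g2).trans g3), s3,
    .switch (.switch (.twist (.refl b) t1) t2) t3, ?_, ?_, ?_, ?_⟩
  · exact isGraded_trans (isGraded_trans (isGraded_trans ⟨fun _ h => h, fun _ h => h⟩ t1.1) t2.1) t3.1
  · apply isStable_of
    intro i hi
    have i1 : i ≠ N := by rintro rfl; omega
    have i2 : i ≠ M := by rintro rfl; omega
    have i3 : i ≠ L := by rintro rfl; omega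
    simp only [RingEquiv.trans_apply, RingEquiv.refl_apply]
    rw [e1, if_neg i2, add_zero, e2, Equiv.swap_apply_of_ne_of_ne i1 i2, e3,
      Equiv.swap_apply_of_ne_of_ne i2 i3]
  · intro i hi m
    have i1 : i ≠ N := by rintro rfl; omega
    have i2 : i ≠ M := by rintro rfl; omega
    have i3 : i ≠ L := by rintro rfl; omega
    by_cases hm : (m : ℕ) < N
    · have m1 : m ≠ N := by rintro rfl; omega
      have m2 : m ≠ M := by rintro rfl; omega
      have m3 : m ≠ L := by rintro rfl; omega
      simp [swapMat, Equiv.swap_apply_of_ne_of_ne, i1, i2, i3, m1, m2, m3, tw]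
    · rw [hbz i m (by omega)]
      by_contra hcon
      have := s3 _ _ hcon
      omega
  · rw [hz]
    simp only [RingEquiv.trans_apply, RingEquiv.refl_apply, map_sum, map_zsmul, e1]
    have key : ∑ i, z i • g3 (g2 (bx n (tw b N M q) i +
        if i = M then q • bx n (tw b N M q) N else 0)) =
        ∑ i, (if i = N then 0 else z i) • g3 (g2 (bx n (tw b N M q) i)) := by
      have h1 : ∀ i, z i • g3 (g2 (bx n (tw b N M q) i +
        if i = M then q • bx n (tw b N M q) N else 0)) =
        (if i = N then 0 else z i) • g3 (g2 (bx n (tw b N M q) i)) +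
        ((if i = N then z N • g3 (g2 (bx n (tw b N M q) N)) else 0) +
        (if i = M then (z M * q) • g3 (g2 (bx n (tw b N M q) N)) else 0)) := by
        intro i
        by_cases h1 : i = N
        · subst h1; simp [nNM]
        · by_cases h2 : i = M
          · subst h2; simp [h1, smul_add, mul_smul]
          · simp [h1, h2]
      rw [Finset.sum_congr rfl fun i _ => h1 i, Finset.sum_add_distrib, Finset.sum_add_distrib]
      simp only [Finset.sum_ite_eq', Finset.mem_univ, if_true]
      rw [← add_smul]
      have : z N + z M * q = 0 := by linarith
      rw [this]; simp
    rw [key]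
    refine Submodule.sum_mem _ fun i _ => ?_
    by_cases h1 : i = N
    · simp [h1]
    by_cases h2 : l ≤ (i : ℕ)
    · rw [hz0 i h2]; simp
    refine Submodule.smul_mem _ _ ?_
    rw [e2, e3]
    apply bx_mem_F
    by_cases h3 : i = M
    · subst h3
      rw [Equiv.swap_apply_right, Equiv.swap_apply_of_ne_of_ne nNM nNL]; omega
    · rw [Equiv.swap_apply_of_ne_of_ne h1 h3]
      by_cases h4 : i = L
      · subst h4; rw [Equiv.swap_apply_right]; omega
      · rw [Equiv.swap_apply_of_ne_of_ne h3 h4]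
        have : (i : ℕ) ≠ L := fun h' => h4 (Fin.ext h')
        omega

end Bott
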